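/- arXiv:cs/0005009 — 2 statements merged into one kernel-verified Lean document; each statement's English description precedes it below -/
import Mathlib

section
/- Termination of the optimised algorithm: every sequence of applications of the optimised completion rules starting from the constraint system {x₀ ⊨ φ}, for a Gr(K_R)-formula φ in NNF, is finite. -/
/-! Core definitions for the graded modal logic Gr(K_R):
syntax, Kripke semantics, NNF, closure, constraint systems,
and the completion rules (optimised and standard). -/

namespace GrK

/-- Gr(K_R)-formulae over propositional atoms (ℕ) and relation names (ℕ).
`ge r n φ` is the counting modality ⟨R⟩_{≥n}φ and `le r n φ` is ⟨R⟩_{≤n}φ. -/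
inductive GFormula : Type where
  | atom : ℕ → GFormula
  | neg  : GFormula → GFormula
  | and  : GFormula → GFormula → GFormula
  | or   : GFormula → GFormula → GFormula
  | ge   : ℕ → ℕ → GFormula → GFormula
  | le   : ℕ → ℕ → GFormula → GFormula
  deriving DecidableEq

/-- A Kripke structure: a nonempty type of worlds, an accessibility relation
for each relation name, and a valuation. -/
structure Kripke where
  W : Type
  nonempty : Nonempty W
  rel : ℕ → W → W → Prop
  val : ℕ → Set W

/-- Satisfaction `M, x ⊨ φ`; the graded modalities count successors
(as a cardinal, to handle infinite structures faithfully). -/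
def GFormula.sat (M : Kripke) : GFormula → M.W → Prop
  | .atom p, x => x ∈ M.val p
  | .neg φ, x => ¬ GFormula.sat M φ x
  | .and φ ψ, x => GFormula.sat M φ x ∧ GFormula.sat M ψ x
  | .or φ ψ, x => GFormula.sat M φ x ∨ GFormula.sat M ψ x
  | .ge r n φ, x => (n : Cardinal) ≤ Cardinal.mk {y : M.W // M.rel r x y ∧ GFormula.sat M φ y}
  | .le r n φ, x => Cardinal.mk {y : M.W // M.rel r x y ∧ GFormula.sat M φ y} ≤ (n : Cardinal)

/-- ♯R^M(x,φ): the number of R-successors of x satisfying φ. -/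
def Kripke.count (M : Kripke) (r : ℕ) (x : M.W) (φ : GFormula) : Cardinal :=
  Cardinal.mk {y : M.W // M.rel r x y ∧ GFormula.sat M φ y}

/-- A formula is satisfiable iff it holds at some world of some Kripke structure. -/
def GFormula.satisfiable (φ : GFormula) : Prop :=
  ∃ (M : Kripke) (x : M.W), GFormula.sat M φ x

/-- Negation normal form: negation occurs only in front of atoms. -/
def GFormula.isNNF : GFormula → Prop
  | .atom _ => True
  | .neg (.atom _) => True
  | .neg _ => False
  | .and φ ψ => GFormula.isNNF φ ∧ GFormula.isNNF ψ
  | .or φ ψ => GFormula.isNNF φ ∧ GFormula.isNNF ψ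
  | .ge _ _ φ => GFormula.isNNF φ
  | .le _ _ φ => GFormula.isNNF φ

/-- ~φ : the NNF of the negation of an NNF formula. -/
def GFormula.nnfNeg : GFormula → GFormula
  | .atom p => .neg (.atom p)
  | .neg φ => φ
  | .and φ ψ => .or φ.nnfNeg ψ.nnfNeg
  | .or φ ψ => .and φ.nnfNeg ψ.nnfNeg
  | .ge r n φ => if n = 0 then .and (.atom 0) (.neg (.atom 0)) else .le r (n - 1) φ
  | .le r n φ => .ge r (n + 1) φ

/-- |φ| : the length of a formula. -/
def GFormula.size : GFormula → ℕ
  | .atom _ => 1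
  | .neg φ => 1 + φ.size
  | .and φ ψ => 1 + φ.size + ψ.size
  | .or φ ψ => 1 + φ.size + ψ.size
  | .ge _ _ φ => 1 + φ.size
  | .le _ _ φ => 1 + φ.size

/-- sub(φ) : the set of subformulae of φ. -/
def GFormula.sub : GFormula → Finset GFormula
  | .atom p => {.atom p}
  | .neg φ => insert (.neg φ) φ.sub
  | .and φ ψ => insert (.and φ ψ) (φ.sub ∪ ψ.sub)
  | .or φ ψ => insert (.or φ ψ) (φ.sub ∪ ψ.sub)
  | .ge r n φ => insert (.ge r n φ) φ.sub
  | .le r n φ => insert (.le r n φ) φ.sub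

/-- Membership in clos(φ): the smallest set containing φ, closed under
immediate subformulae of ∧, ∨ and the graded modalities, and closed under ~. -/
inductive InClos (φ : GFormula) : GFormula → Prop
  | base : InClos φ φ
  | andL {ψ₁ ψ₂} : InClos φ (.and ψ₁ ψ₂) → InClos φ ψ₁
  | andR {ψ₁ ψ₂} : InClos φ (.and ψ₁ ψ₂) → InClos φ ψ₂
  | orL {ψ₁ ψ₂} : InClos φ (.or ψ₁ ψ₂) → InClos φ ψ₁
  | orR {ψ₁ ψ₂} : InClos φ (.or ψ₁ ψ₂) → InClos φ ψ₂
  | ge {r n ψ} : InClos φ (.ge r n ψ) → InClos φ ψ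
  | le {r n ψ} : InClos φ (.le r n ψ) → InClos φ ψ
  | nnfNeg {ψ} : InClos φ ψ → InClos φ ψ.nnfNeg

/-- clos(φ) as a set of formulae. -/
def clos (φ : GFormula) : Set GFormula := {ψ | InClos φ ψ}

/-- A constraint: either `x ⊨ ψ` or `R x y`;
a constraint system (c.s.) is a finite set of constraints. -/
inductive Constraint : Type where
  | sat : ℕ → GFormula → Constraint
  | rel : ℕ → ℕ → ℕ → Constraint
  deriving DecidableEq

/-- The variables occurring in a constraint. -/
def Constraint.vars : Constraint → Finset ℕ
  | .sat x _ => {x}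
  | .rel _ x y => {x, y}

/-- ♯R^S(x,ψ): the number of variables y with {Rxy, y ⊨ ψ} ⊆ S. -/
noncomputable def countS (S : Finset Constraint) (r x : ℕ) (ψ : GFormula) : ℕ :=
  Set.ncard {y : ℕ | Constraint.rel r x y ∈ S ∧ Constraint.sat y ψ ∈ S}

/-- A clash: {x ⊨ p, x ⊨ ¬p} ⊆ S, or x ⊨ ⟨R⟩_{≤n}ψ ∈ S with ♯R^S(x,ψ) > n. -/
def hasClash (S : Finset Constraint) : Prop :=
  (∃ x p, Constraint.sat x (.atom p) ∈ S ∧ Constraint.sat x (.neg (.atom p)) ∈ S) ∨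
  (∃ x r n ψ, Constraint.sat x (.le r n ψ) ∈ S ∧ n < countS S r x ψ)

/-- `y` is a fresh variable w.r.t. S. -/
def freshIn (y : ℕ) (S : Finset Constraint) : Prop := ∀ c ∈ S, y ∉ c.vars

/-- The →∧-rule is applicable to a constraint for x in S. -/
def andApplicable (S : Finset Constraint) (x : ℕ) : Prop :=
  ∃ ψ₁ ψ₂, Constraint.sat x (.and ψ₁ ψ₂) ∈ S ∧
    ¬ (Constraint.sat x ψ₁ ∈ S ∧ Constraint.sat x ψ₂ ∈ S)

/-- The →∨-rule is applicable to a constraint for x in S. -/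
def orApplicable (S : Finset Constraint) (x : ℕ) : Prop :=
  ∃ ψ₁ ψ₂, Constraint.sat x (.or ψ₁ ψ₂) ∈ S ∧
    Constraint.sat x ψ₁ ∉ S ∧ Constraint.sat x ψ₂ ∉ S

/-- One application of the →∧-rule. -/
inductive StepAnd : Finset Constraint → Finset Constraint → Prop
  | mk (S : Finset Constraint) (x : ℕ) (ψ₁ ψ₂ : GFormula)
      (h : Constraint.sat x (.and ψ₁ ψ₂) ∈ S)
      (h2 : ¬ (Constraint.sat x ψ₁ ∈ S ∧ Constraint.sat x ψ₂ ∈ S)) :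
      StepAnd S (insert (Constraint.sat x ψ₁) (insert (Constraint.sat x ψ₂) S))

/-- One application of the →∨-rule. -/
inductive StepOr : Finset Constraint → Finset Constraint → Prop
  | mk (S : Finset Constraint) (x : ℕ) (ψ₁ ψ₂ χ : GFormula)
      (h : Constraint.sat x (.or ψ₁ ψ₂) ∈ S)
      (h1 : Constraint.sat x ψ₁ ∉ S) (h2 : Constraint.sat x ψ₂ ∉ S)
      (hχ : χ = ψ₁ ∨ χ = ψ₂) :
      StepOr S (insert (Constraint.sat x χ) S)

/-- One application of the optimised →≥-rule: if x ⊨ ⟨R⟩_{≥n}ψ ∈ S,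
♯R^S(x,ψ) < n and no →∧/→∨ rule applies to a constraint for x, add (for a
fresh y) the constraints Rxy, y ⊨ ψ, and y ⊨ χᵢ with χᵢ ∈ {ψᵢ, ~ψᵢ} for every
ψᵢ occurring in a graded constraint ⟨R⟩_{⋈m}ψᵢ for x with the same relation R. -/
inductive StepGe : Finset Constraint → Finset Constraint → Prop
  | mk (S S' : Finset Constraint) (x r n : ℕ) (ψ : GFormula) (y : ℕ)
      (f : GFormula → GFormula)
      (h : Constraint.sat x (.ge r n ψ) ∈ S)
      (hc : countS S r x ψ < n)
      (hna : ¬ andApplicable S x) (hno : ¬ orApplicable S x)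
      (hy : freshIn y S)
      (hf : ∀ ψ', f ψ' = ψ' ∨ f ψ' = ψ'.nnfNeg)
      (hS' : (S' : Set Constraint) = (S : Set Constraint) ∪
          {Constraint.rel r x y, Constraint.sat y ψ} ∪
          {c | ∃ ψ' m,
            (Constraint.sat x (.ge r m ψ') ∈ S ∨ Constraint.sat x (.le r m ψ') ∈ S) ∧
            c = Constraint.sat y (f ψ')}) :
      StepGe S S'

/-- One application of any optimised completion rule. -/
def OptStep (S S' : Finset Constraint) : Prop := StepAnd S S' ∨ StepOr S S' ∨ StepGe S S'

/-- The initial constraint system {x₀ ⊨ φ}. -/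
def initCS (x₀ : ℕ) (φ : GFormula) : Finset Constraint := {Constraint.sat x₀ φ}

/-- S is obtained from {x₀ ⊨ φ} by a sequence of optimised rule applications. -/
def OptReach (x₀ : ℕ) (φ : GFormula) (S : Finset Constraint) : Prop :=
  Relation.ReflTransGen OptStep (initCS x₀ φ) S

/-- A c.s. is complete iff no optimised rule is applicable. -/
def OptComplete (S : Finset Constraint) : Prop := ¬ ∃ S', OptStep S S'

/-- The edges of the graph G(S) induced by a c.s. S. -/
def edge (S : Finset Constraint) (x y : ℕ) : Prop := ∃ r, Constraint.rel r x y ∈ S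

/-- The variable x occurs in S (x is a node of G(S)). -/
def occursIn (x : ℕ) (S : Finset Constraint) : Prop := ∃ c ∈ S, x ∈ c.vars

/-- Satisfiability of a constraint system. -/
def csSat (S : Finset Constraint) : Prop :=
  ∃ (M : Kripke) (α : ℕ → M.W),
    (∀ r x y z, Constraint.rel r x y ∈ S → Constraint.rel r x z ∈ S → y ≠ z → α y ≠ α z) ∧
    (∀ x ψ, Constraint.sat x ψ ∈ S → GFormula.sat M ψ (α x)) ∧
    (∀ r x y, Constraint.rel r x y ∈ S → M.rel r (α x) (α y))

/-- The canonical structure M_S induced by a c.s. S (on the variables,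
with accessibility and valuation read off from S). -/
def canonical (S : Finset Constraint) : Kripke where
  W := ℕ
  nonempty := ⟨0⟩
  rel := fun r x y => Constraint.rel r x y ∈ S
  val := fun p => {x | Constraint.sat x (.atom p) ∈ S}

/-- Renaming a variable: `rename y z c` replaces y by z in the constraint c. -/
def Constraint.rename (y z : ℕ) : Constraint → Constraint
  | .sat x ψ => .sat (if x = y then z else x) ψ
  | .rel r a b => .rel r (if a = y then z else a) (if b = y then z else b)

/-- [z/y]S : replace every occurrence of y by z in S. -/
def renameCS (S : Finset Constraint) (y z : ℕ) : Finset Constraint :=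
  S.image (Constraint.rename y z)

/-- The replacement of y by z in S is safe. -/
def safeReplace (S : Finset Constraint) (y z : ℕ) : Prop :=
  ∀ x r n ψ, Constraint.sat x (.ge r n ψ) ∈ S → Constraint.rel r x y ∈ S →
    Constraint.rel r x z ∈ S → n ≤ countS (renameCS S y z) r x ψ

/-- One application of a standard (Hollunder–Baader) completion rule. -/
inductive StdStep : Finset Constraint → Finset Constraint → Prop
  | and (S : Finset Constraint) (x : ℕ) (ψ₁ ψ₂ : GFormula)
      (h : Constraint.sat x (.and ψ₁ ψ₂) ∈ S)
      (h2 : ¬ (Constraint.sat x ψ₁ ∈ S ∧ Constraint.sat x ψ₂ ∈ S)) :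
      StdStep S (insert (Constraint.sat x ψ₁) (insert (Constraint.sat x ψ₂) S))
  | or (S : Finset Constraint) (x : ℕ) (ψ₁ ψ₂ χ : GFormula)
      (h : Constraint.sat x (.or ψ₁ ψ₂) ∈ S)
      (h1 : Constraint.sat x ψ₁ ∉ S) (h2 : Constraint.sat x ψ₂ ∉ S)
      (hχ : χ = ψ₁ ∨ χ = ψ₂) :
      StdStep S (insert (Constraint.sat x χ) S)
  | choose (S : Finset Constraint) (x r n : ℕ) (ψ χ : GFormula) (y : ℕ)
      (h : Constraint.sat x (.ge r n ψ) ∈ S ∨ Constraint.sat x (.le r n ψ) ∈ S)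
      (hr : Constraint.rel r x y ∈ S)
      (h1 : Constraint.sat y ψ ∉ S) (h2 : Constraint.sat y ψ.nnfNeg ∉ S)
      (hχ : χ = ψ ∨ χ = ψ.nnfNeg) :
      StdStep S (insert (Constraint.sat y χ) S)
  | ge (S : Finset Constraint) (x r n : ℕ) (ψ : GFormula) (y : ℕ)
      (h : Constraint.sat x (.ge r n ψ) ∈ S)
      (hc : countS S r x ψ < n)
      (hy : freshIn y S) :
      StdStep S (insert (Constraint.rel r x y) (insert (Constraint.sat y ψ) S))
  | le (S : Finset Constraint) (x r n : ℕ) (ψ : GFormula) (y z : ℕ)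
      (h : Constraint.sat x (.le r n ψ) ∈ S)
      (hc : n < countS S r x ψ)
      (hyz : y ≠ z)
      (h1 : Constraint.rel r x y ∈ S) (h2 : Constraint.rel r x z ∈ S)
      (h3 : Constraint.sat y ψ ∈ S) (h4 : Constraint.sat z ψ ∈ S)
      (hsafe : safeReplace S y z) :
      StdStep S (renameCS S y z)

/-- S is obtained from {x₀ ⊨ φ} by a sequence of standard rule applications. -/
def StdReach (x₀ : ℕ) (φ : GFormula) (S : Finset Constraint) : Prop :=
  Relation.ReflTransGen StdStep (initCS x₀ φ) S

/-- A c.s. is complete (for the standard rules) iff no rule is applicable. -/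
def StdComplete (S : Finset Constraint) : Prop := ¬ ∃ S', StdStep S S'

end GrK

namespace GrK

/-- modal depth -/
def GFormula.md : GFormula → ℕ
  | .atom _ => 0
  | .neg φ => φ.md
  | .and φ ψ => max φ.md ψ.md
  | .or φ ψ => max φ.md ψ.md
  | .ge _ _ φ => φ.md + 1
  | .le _ _ φ => φ.md + 1

theorem md_nnfNeg (φ : GFormula) : φ.nnfNeg.md ≤ φ.md := by
  induction φ with
  | atom p => simp [GFormula.nnfNeg, GFormula.md]
  | neg φ ih => simp [GFormula.nnfNeg, GFormula.md]
  | and a b iha ihb => simp only [GFormula.nnfNeg, GFormula.md]; omega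
  | or a b iha ihb => simp only [GFormula.nnfNeg, GFormula.md]; omega
  | ge r n a ih =>
    simp only [GFormula.nnfNeg]
    split_ifs <;> simp [GFormula.md]
  | le r n a ih => simp [GFormula.nnfNeg, GFormula.md]

theorem mem_sub_self (φ : GFormula) : φ ∈ φ.sub := by
  cases φ <;> simp [GFormula.sub]

theorem sub_trans {a b : GFormula} (c : GFormula) (h : a ∈ b.sub) (h' : b ∈ c.sub) :
    a ∈ c.sub := by
  induction c with
  | atom p =>
    simp only [GFormula.sub, Finset.mem_singleton] at h'
    subst h'; exact h
  | neg φ ih =>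
    simp only [GFormula.sub, Finset.mem_insert] at h'
    rcases h' with rfl | h'
    · exact h
    · simp [GFormula.sub, ih h']
  | and p q ihp ihq =>
    simp only [GFormula.sub, Finset.mem_insert, Finset.mem_union] at h'
    rcases h' with rfl | h' | h'
    · exact h
    · simp [GFormula.sub, ihp h']
    · simp [GFormula.sub, ihq h']
  | or p q ihp ihq =>
    simp only [GFormula.sub, Finset.mem_insert, Finset.mem_union] at h'
    rcases h' with rfl | h' | h'
    · exact h
    · simp [GFormula.sub, ihp h']
    · simp [GFormula.sub, ihq h']
  | ge r n φ ih =>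
    simp only [GFormula.sub, Finset.mem_insert] at h'
    rcases h' with rfl | h'
    · exact h
    · simp [GFormula.sub, ih h']
  | le r n φ ih =>
    simp only [GFormula.sub, Finset.mem_insert] at h'
    rcases h' with rfl | h'
    · exact h
    · simp [GFormula.sub, ih h']

theorem md_sub {a : GFormula} (c : GFormula) (h : a ∈ c.sub) : a.md ≤ c.md := by
  induction c with
  | atom p =>
    simp only [GFormula.sub, Finset.mem_singleton] at h
    subst h; exact le_rfl
  | neg φ ih =>
    simp only [GFormula.sub, Finset.mem_insert] at h
    rcases h with rfl | h
    · exact le_rfl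
    · exact ih h
  | and p q ihp ihq =>
    simp only [GFormula.sub, Finset.mem_insert, Finset.mem_union] at h
    rcases h with rfl | h | h
    · exact le_rfl
    · exact (ihp h).trans (le_max_left _ _)
    · exact (ihq h).trans (le_max_right _ _)
  | or p q ihp ihq =>
    simp only [GFormula.sub, Finset.mem_insert, Finset.mem_union] at h
    rcases h with rfl | h | h
    · exact le_rfl
    · exact (ihp h).trans (le_max_left _ _)
    · exact (ihq h).trans (le_max_right _ _)
  | ge r n φ ih =>
    simp only [GFormula.sub, Finset.mem_insert] at h
    rcases h with rfl | h
    · exact le_rfl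
    · exact (ih h).trans (Nat.le_succ _)
  | le r n φ ih =>
    simp only [GFormula.sub, Finset.mem_insert] at h
    rcases h with rfl | h
    · exact le_rfl
    · exact (ih h).trans (Nat.le_succ _)

/-- A propositional step: only subformulae are added at existing variables. -/
def PropStep (S S' : Finset Constraint) : Prop :=
  (∀ r x y, Constraint.rel r x y ∈ S' → Constraint.rel r x y ∈ S) ∧
  ∀ z ψ, Constraint.sat z ψ ∈ S' → ∃ χ, Constraint.sat z χ ∈ S ∧ ψ ∈ χ.sub

/-- A generating step at `x` with relation `r`. -/
def GenStep (S S' : Finset Constraint) (x r n : ℕ) (ψ : GFormula) (y : ℕ) : Prop :=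
  freshIn y S ∧ Constraint.sat x (.ge r n ψ) ∈ S ∧ countS S r x ψ < n ∧
  Constraint.rel r x y ∈ S' ∧ Constraint.sat y ψ ∈ S' ∧
  ∀ c ∈ S', c ∈ S ∨ c = Constraint.rel r x y ∨
    ∃ χ χ', c = Constraint.sat y χ ∧ Constraint.sat x χ' ∈ S ∧ χ.md < χ'.md

theorem step_cases {S S' : Finset Constraint} (h : OptStep S S') :
    S ⊂ S' ∧ (PropStep S S' ∨ ∃ x r n ψ y, GenStep S S' x r n ψ y) := by
  rcases h with h | h | h
  · obtain ⟨x, a, b, h, h2⟩ := h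
    refine ⟨?_, Or.inl ⟨?_, ?_⟩⟩
    · refine ⟨fun c hc => by simp [hc], fun hs => h2 ⟨hs (by simp), hs (by simp)⟩⟩
    · intro r x y; simp
    · intro z ψ hz
      simp only [Finset.mem_insert, Constraint.sat.injEq] at hz
      rcases hz with ⟨rfl, rfl⟩ | ⟨rfl, rfl⟩ | hz
      · exact ⟨_, h, by simp [GFormula.sub, mem_sub_self]⟩
      · exact ⟨_, h, by simp [GFormula.sub, mem_sub_self]⟩
      · exact ⟨_, hz, mem_sub_self _⟩
  · obtain ⟨x, a, b, χ, h, h1, h2, hχ⟩ := h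
    refine ⟨?_, Or.inl ⟨?_, ?_⟩⟩
    · refine ⟨fun c hc => by simp [hc], fun hs => ?_⟩
      have := hs (Finset.mem_insert_self _ _)
      rcases hχ with rfl | rfl
      · exact h1 this
      · exact h2 this
    · intro r x y; simp
    · intro z ψ hz
      simp only [Finset.mem_insert, Constraint.sat.injEq] at hz
      rcases hz with ⟨rfl, rfl⟩ | hz
      · refine ⟨_, h, ?_⟩
        rcases hχ with rfl | rfl <;> simp [GFormula.sub, mem_sub_self]
      · exact ⟨_, hz, mem_sub_self _⟩
  · obtain ⟨x, r, n, ψ, y, f, h, hc, -, -, hy, hf, hS'⟩ := h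
    have hm : ∀ c, c ∈ S' ↔ _ := fun c => Set.ext_iff.1 hS' c
    simp only [Set.mem_union, Set.mem_insert_iff, Set.mem_singleton_iff, Set.mem_ofPred_eq,
      Finset.mem_coe] at hm
    refine ⟨⟨fun c hc => (hm c).2 (Or.inl (Or.inl hc)), fun hs => ?_⟩, Or.inr ⟨x, r, n, ψ, y,
      hy, h, hc, (hm _).2 (by simp), (hm _).2 (by simp), ?_⟩⟩
    · exact hy _ (hs ((hm (Constraint.rel r x y)).2 (by simp))) (by simp [Constraint.vars])
    · intro c hc
      rcases (hm c).1 hc with (hc | rfl | rfl) | ⟨ψ', m, h', rfl⟩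
      · exact Or.inl hc
      · exact Or.inr (Or.inl rfl)
      · exact Or.inr (Or.inr ⟨_, _, rfl, h, Nat.lt_succ_self _⟩)
      · have hle : (f ψ').md ≤ ψ'.md := by
          rcases hf ψ' with e | e <;> rw [e]
          exact md_nnfNeg _
        rcases h' with h' | h'
        · exact Or.inr (Or.inr ⟨_, _, rfl, h', Nat.lt_succ_of_le hle⟩)
        · exact Or.inr (Or.inr ⟨_, _, rfl, h', Nat.lt_succ_of_le hle⟩)

theorem countS_finite (S : Finset Constraint) (r x : ℕ) (ψ : GFormula) :
    {y : ℕ | Constraint.rel r x y ∈ S ∧ Constraint.sat y ψ ∈ S}.Finite := by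
  refine Set.Finite.of_finite_image (f := fun y => Constraint.rel r x y)
    (S.finite_toSet.subset ?_) (fun a _ b _ h => by simpa using h)
  rintro _ ⟨y, hy, rfl⟩
  exact hy.1

theorem countS_mono {S S' : Finset Constraint} (h : S ⊆ S') (r x : ℕ) (ψ : GFormula) :
    countS S r x ψ ≤ countS S' r x ψ :=
  Set.ncard_le_ncard (fun _ hy => ⟨h hy.1, h hy.2⟩) (countS_finite _ _ _ _)

theorem countS_lt {S S' : Finset Constraint} (h : S ⊆ S') {r x n : ℕ} {ψ : GFormula} {y : ℕ}
    (hg : GenStep S S' x r n ψ y) : countS S r x ψ < countS S' r x ψ := by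
  obtain ⟨hy, -, -, h1, h2, -⟩ := hg
  refine Set.ncard_lt_ncard ⟨fun _ hy => ⟨h hy.1, h hy.2⟩, fun hs => ?_⟩ (countS_finite _ _ _ _)
  exact hy _ (hs (show y ∈ _ from ⟨h1, h2⟩)).1 (by simp [Constraint.vars])

section
variable {f : ℕ → Finset Constraint} {x₀ : ℕ} {φ : GFormula}

theorem f_mono (hf : ∀ n, OptStep (f n) (f (n + 1))) : Monotone f :=
  monotone_nat_of_le_succ fun n => (step_cases (hf n)).1.1

/-- formulae at an existing variable only come from subformulae -/
theorem label_sub (hf : ∀ n, OptStep (f n) (f (n + 1))) {x n : ℕ} (hx : occursIn x (f n)) :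
    ∀ k ψ, Constraint.sat x ψ ∈ f (n + k) → ∃ χ, Constraint.sat x χ ∈ f n ∧ ψ ∈ χ.sub := by
  intro k
  induction k with
  | zero => exact fun ψ h => ⟨ψ, h, mem_sub_self _⟩
  | succ k ih =>
    intro ψ h
    rcases (step_cases (hf (n + k))).2 with hp | ⟨x', r, m, ψ', y, hg⟩
    · obtain ⟨χ, h1, h2⟩ := hp.2 _ _ h
      obtain ⟨χ', h3, h4⟩ := ih χ h1
      exact ⟨χ', h3, sub_trans _ h2 h4⟩
    · obtain ⟨hy, -, -, -, -, hc⟩ := hg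
      rcases hc _ h with h | h | ⟨χ, χ', h, -⟩
      · exact ih _ h
      · cases h
      · cases h
        obtain ⟨c, hc, hxc⟩ := hx
        exact absurd hxc (hy c (f_mono hf (Nat.le_add_right n k) hc))

theorem label_finite (hf : ∀ n, OptStep (f n) (f (n + 1))) (x : ℕ) :
    {ψ | ∃ n, Constraint.sat x ψ ∈ f n}.Finite := by
  by_cases hx : ∃ n, occursIn x (f n)
  · obtain ⟨n, hn⟩ := hx
    have hfin : {χ | Constraint.sat x χ ∈ f n}.Finite := by
      refine Set.Finite.of_finite_image (f := fun y => Constraint.sat x y)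
        ((f n).finite_toSet.subset ?_) (fun a _ b _ h => by simpa using h)
      rintro _ ⟨y, hy, rfl⟩
      exact hy
    refine (hfin.biUnion (t := fun χ => (χ.sub : Set GFormula))
      fun χ _ => Finset.finite_toSet _).subset ?_
    rintro ψ ⟨m, hm⟩
    obtain ⟨χ, h1, h2⟩ := label_sub hf hn m ψ (f_mono hf (Nat.le_add_left m n) hm)
    exact Set.mem_biUnion (show χ ∈ {χ | Constraint.sat x χ ∈ f n} from h1) h2
  · convert Set.finite_empty
    rw [Set.eq_empty_iff_forall_notMem]
    rintro ψ ⟨n, hn⟩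
    exact hx ⟨n, _, hn, by simp [Constraint.vars]⟩

theorem fire_finite (hf : ∀ n, OptStep (f n) (f (n + 1))) (x r n : ℕ) (ψ : GFormula) :
    {m | ∃ y, GenStep (f m) (f (m + 1)) x r n ψ y}.Finite := by
  refine Set.Finite.of_injOn (f := fun m => countS (f m) r x ψ) (t := Set.Iio n) ?_ ?_
    (Set.finite_Iio n)
  · rintro m ⟨y, hy⟩
    exact hy.2.2.1
  · have key : ∀ a b, (∃ y, GenStep (f a) (f (a + 1)) x r n ψ y) → a < b →
        countS (f a) r x ψ < countS (f b) r x ψ := by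
      rintro a b ⟨y, hy⟩ hab
      exact (countS_lt (f_mono hf (Nat.le_succ a)) hy).trans_le
        (countS_mono (f_mono hf hab) _ _ _)
    intro a ha b hb hab
    rcases lt_trichotomy a b with h | h | h
    · exact absurd hab (key a b ha h).ne
    · exact h
    · exact absurd hab (key b a hb h).ne'

theorem rel_finite (h0 : f 0 = initCS x₀ φ) (hf : ∀ n, OptStep (f n) (f (n + 1))) (x : ℕ) :
    {c | ∃ r y n, c = Constraint.rel r x y ∧ c ∈ f n}.Finite := by
  have hA : {m | ∃ r n ψ y, GenStep (f m) (f (m + 1)) x r n ψ y}.Finite := by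
    refine ((label_finite hf x).biUnion (t := fun χ =>
      {m | ∃ r n ψ, χ = GFormula.ge r n ψ ∧ ∃ y, GenStep (f m) (f (m + 1)) x r n ψ y})
      ?_).subset ?_
    · intro χ _
      cases χ with
      | ge r n ψ =>
        refine (fire_finite hf x r n ψ).subset ?_
        rintro m ⟨r', n', ψ', e, h⟩
        cases e
        exact h
      | _ => simp
    · rintro m ⟨r, n, ψ, y, h⟩
      exact Set.mem_biUnion (x := GFormula.ge r n ψ) ⟨m, h.2.1⟩ ⟨r, n, ψ, rfl, y, h⟩
  refine (hA.biUnion (t := fun m => (f (m + 1) : Set Constraint))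
    fun _ _ => Finset.finite_toSet _).subset ?_
  rintro _ ⟨r, y, n, rfl, hn⟩
  induction n with
  | zero => simp [h0, initCS] at hn
  | succ n ih =>
    rcases (step_cases (hf n)).2 with hp | ⟨x', r', m, ψ', y', hg⟩
    · exact ih (hp.1 _ _ _ hn)
    · rcases hg.2.2.2.2.2 _ hn with h | h | ⟨χ, χ', h, -⟩
      · exact ih h
      · cases h
        exact Set.mem_biUnion (x := n) ⟨r, m, ψ', y, hg⟩ hn
      · cases h

theorem rel_inv (h0 : f 0 = initCS x₀ φ) (hf : ∀ n, OptStep (f n) (f (n + 1))) :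
    ∀ n r x y, Constraint.rel r x y ∈ f n → (∃ χ, Constraint.sat y χ ∈ f n) ∧
      ∀ χ, Constraint.sat y χ ∈ f n → ∃ χ', Constraint.sat x χ' ∈ f n ∧ χ.md < χ'.md := by
  intro n
  induction n with
  | zero => intro r x y h; simp [h0, initCS] at h
  | succ n ih =>
    intro r x y h
    have hs := (step_cases (hf n)).1.1
    rcases (step_cases (hf n)).2 with hp | ⟨x', r', m, ψ', y', hg⟩
    · obtain ⟨⟨χ, h1⟩, h2⟩ := ih r x y (hp.1 _ _ _ h)
      refine ⟨⟨χ, hs h1⟩, fun χ hχ => ?_⟩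
      obtain ⟨χ', h3, h4⟩ := hp.2 _ _ hχ
      obtain ⟨χ'', h5, h6⟩ := h2 _ h3
      exact ⟨χ'', hs h5, (md_sub _ h4).trans_lt h6⟩
    · obtain ⟨hy, -, -, h1, h2, hc⟩ := hg
      rcases hc _ h with h | h | ⟨χ, χ', h, -⟩
      · obtain ⟨⟨χ, h3⟩, h4⟩ := ih r x y h
        refine ⟨⟨χ, hs h3⟩, fun χ hχ => ?_⟩
        rcases hc _ hχ with h5 | h5 | ⟨χ1, χ2, h5, -⟩
        · obtain ⟨χ'', h5, h6⟩ := h4 _ h5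
          exact ⟨χ'', hs h5, h6⟩
        · cases h5
        · cases h5
          exact absurd (by simp [Constraint.vars]) (hy _ h)
      · cases h
        refine ⟨⟨_, h2⟩, fun χ hχ => ?_⟩
        rcases hc _ hχ with h5 | h5 | ⟨χ1, χ2, h5, h6, h7⟩
        · exact absurd (by simp [Constraint.vars]) (hy _ h5)
        · cases h5
        · cases h5
          exact ⟨_, hs h6, h7⟩
      · cases h

/-- variables at distance `k` from `x₀` -/
def level (f : ℕ → Finset Constraint) (x₀ : ℕ) : ℕ → Set ℕ
  | 0 => {x₀}
  | k + 1 => {y | ∃ x ∈ level f x₀ k, ∃ r n, Constraint.rel r x y ∈ f n}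

theorem level_finite (h0 : f 0 = initCS x₀ φ) (hf : ∀ n, OptStep (f n) (f (n + 1))) (k : ℕ) :
    (level f x₀ k).Finite := by
  induction k with
  | zero => exact Set.finite_singleton _
  | succ k ih =>
    refine (ih.biUnion (t := fun x => ⋃ c ∈ {c | ∃ r y n, c = Constraint.rel r x y ∧ c ∈ f n},
      (c.vars : Set ℕ)) fun x _ => (rel_finite h0 hf x).biUnion
        fun c _ => Finset.finite_toSet _).subset ?_
    rintro y ⟨x, hx, r, n, h⟩
    refine Set.mem_biUnion hx (Set.mem_biUnion (x := Constraint.rel r x y) ⟨r, y, n, rfl, h⟩ ?_)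
    simp [Constraint.vars]

theorem level_md (h0 : f 0 = initCS x₀ φ) (hf : ∀ n, OptStep (f n) (f (n + 1))) (k : ℕ) :
    ∀ y ∈ level f x₀ k, (∃ n χ, Constraint.sat y χ ∈ f n) ∧
      ∀ n χ, Constraint.sat y χ ∈ f n → χ.md + k ≤ φ.md := by
  induction k with
  | zero =>
    rintro y rfl
    have hm : Constraint.sat y φ ∈ f 0 := by simp [h0, initCS]
    refine ⟨⟨0, φ, hm⟩, fun n χ h => ?_⟩
    obtain ⟨χ', h1, h2⟩ := label_sub hf (x := y) (n := 0) ⟨_, hm, by simp [Constraint.vars]⟩ n χ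
      (by simpa using h)
    simp only [h0, initCS, Finset.mem_singleton, Constraint.sat.injEq, true_and] at h1
    subst h1
    exact md_sub _ h2
  | succ k ih =>
    rintro y ⟨x, hx, r, n, h⟩
    obtain ⟨χ, hχ⟩ := (rel_inv h0 hf n r x y h).1
    refine ⟨⟨n, χ, hχ⟩, fun m χ hχ => ?_⟩
    obtain ⟨χ', h1, h2⟩ := (rel_inv h0 hf (max n m) r x y
      (f_mono hf (le_max_left _ _) h)).2 χ (f_mono hf (le_max_right _ _) hχ)
    have := (ih x hx).2 _ _ h1
    omega

theorem occurs_level (h0 : f 0 = initCS x₀ φ) (hf : ∀ n, OptStep (f n) (f (n + 1))) :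
    ∀ n y, occursIn y (f n) → ∃ k, y ∈ level f x₀ k := by
  intro n
  induction n with
  | zero =>
    rintro y ⟨c, hc, hy⟩
    simp only [h0, initCS, Finset.mem_singleton] at hc
    subst hc
    exact ⟨0, by simpa [Constraint.vars, level] using hy⟩
  | succ n ih =>
    rintro y ⟨c, hc, hy⟩
    rcases (step_cases (hf n)).2 with hp | ⟨x', r', m, ψ', y', hg⟩
    · cases c with
      | sat z ψ =>
        obtain ⟨χ, h1, -⟩ := hp.2 _ _ hc
        exact ih y ⟨_, h1, hy⟩
      | rel r a b => exact ih y ⟨_, hp.1 _ _ _ hc, hy⟩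
    · obtain ⟨-, hx, -, h1, -, hcc⟩ := hg
      obtain ⟨k, hk⟩ := ih x' ⟨_, hx, by simp [Constraint.vars]⟩
      have hk' : y' ∈ level f x₀ (k + 1) := ⟨x', hk, r', n + 1, h1⟩
      rcases hcc c hc with h | rfl | ⟨χ, χ', rfl, -⟩
      · exact ih y ⟨c, h, hy⟩
      · simp only [Constraint.vars, Finset.mem_insert, Finset.mem_singleton] at hy
        rcases hy with rfl | rfl
        · exact ⟨k, hk⟩
        · exact ⟨_, hk'⟩
      · simp only [Constraint.vars, Finset.mem_singleton] at hy
        subst hy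
        exact ⟨_, hk'⟩

theorem all_finite (h0 : f 0 = initCS x₀ φ) (hf : ∀ n, OptStep (f n) (f (n + 1))) :
    {c | ∃ n, c ∈ f n}.Finite := by
  have hV : (⋃ k ∈ Set.Iic φ.md, level f x₀ k).Finite :=
    (Set.finite_Iic _).biUnion fun k _ => level_finite h0 hf k
  have hmem : ∀ n y, occursIn y (f n) → y ∈ ⋃ k ∈ Set.Iic φ.md, level f x₀ k := by
    intro n y hy
    obtain ⟨k, hk⟩ := occurs_level h0 hf n y hy
    obtain ⟨⟨m, χ, h1⟩, h2⟩ := level_md h0 hf k y hk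
    have := h2 _ _ h1
    exact Set.mem_biUnion (show k ∈ Set.Iic φ.md by simp only [Set.mem_Iic]; omega) hk
  refine (hV.biUnion (t := fun x => (Constraint.sat x '' {ψ | ∃ n, Constraint.sat x ψ ∈ f n}) ∪
    {c | ∃ r y n, c = Constraint.rel r x y ∧ c ∈ f n}) fun x _ =>
      ((label_finite hf x).image _).union (rel_finite h0 hf x)).subset ?_
  rintro c ⟨n, hc⟩
  cases c with
  | sat x ψ =>
    exact Set.mem_biUnion (hmem n x ⟨_, hc, by simp [Constraint.vars]⟩)
      (Or.inl ⟨ψ, ⟨n, hc⟩, rfl⟩)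
  | rel r x y =>
    exact Set.mem_biUnion (hmem n x ⟨_, hc, by simp [Constraint.vars]⟩)
      (Or.inr ⟨r, y, n, rfl, hc⟩)

end

end GrK

open GrK in
/-- termination of the optimised algorithm: there is no infinite
sequence of applications of the optimised completion rules starting from
{x₀ ⊨ φ}, for φ in NNF. -/
theorem stmt_7 (φ : GFormula) (hNNF : φ.isNNF) (x₀ : ℕ) :
    ¬ ∃ f : ℕ → Finset Constraint,
        f 0 = initCS x₀ φ ∧ ∀ n, OptStep (f n) (f (n + 1)) := by
  rintro ⟨f, h0, hf⟩
  have hfin := all_finite h0 hf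
  have hsm : StrictMono f := strictMono_nat_of_lt_succ fun n => (step_cases (hf n)).1
  have hsub : ∀ n, f n ⊆ hfin.toFinset := fun n c hc => by
    simp only [Set.Finite.mem_toFinset, Set.mem_ofPred_eq]
    exact ⟨n, hc⟩
  have hinf : (Set.range f).Infinite := Set.infinite_range_of_injective hsm.injective
  refine hinf ((Finset.finite_toSet hfin.toFinset.powerset).subset ?_)
  rintro _ ⟨n, rfl⟩
  simpa using hsub n
end

section
/- Soundness of the optimised algorithm: let φ be a Gr(K_R)-formula in NNF. If some sequence of applications of the optimised completion rules starting with {x₀ ⊨ φ} results in a complete and clash-free constraint system, then φ is satisfiable; indeed the canonical structure M_S of the resulting system S satisfies M_S, x₀ ⊨ φ. -/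
namespace GrK

def Inv (S : Finset Constraint) : Prop :=
  ∀ r x y, Constraint.rel r x y ∈ S → ¬ andApplicable S x ∧ ¬ orApplicable S x ∧
    ∀ m ψ, (Constraint.sat x (.ge r m ψ) ∈ S ∨ Constraint.sat x (.le r m ψ) ∈ S) →
      Constraint.sat y ψ ∈ S ∨ Constraint.sat y ψ.nnfNeg ∈ S

/-- Transfer of the invariant for one edge along an extension that leaves the
constraints on `x` unchanged. -/
theorem inv_edge_mono {S S' : Finset Constraint} {r x y : ℕ} (hsub : S ⊆ S')
    (hx : ∀ ψ, Constraint.sat x ψ ∈ S' → Constraint.sat x ψ ∈ S)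
    (h : ¬ andApplicable S x ∧ ¬ orApplicable S x ∧
    ∀ m ψ, (Constraint.sat x (.ge r m ψ) ∈ S ∨ Constraint.sat x (.le r m ψ) ∈ S) →
      Constraint.sat y ψ ∈ S ∨ Constraint.sat y ψ.nnfNeg ∈ S) :
    ¬ andApplicable S' x ∧ ¬ orApplicable S' x ∧
    ∀ m ψ, (Constraint.sat x (.ge r m ψ) ∈ S' ∨ Constraint.sat x (.le r m ψ) ∈ S') →
      Constraint.sat y ψ ∈ S' ∨ Constraint.sat y ψ.nnfNeg ∈ S' := by
  obtain ⟨h1, h2, h3⟩ := h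
  refine ⟨?_, ?_, ?_⟩
  · rintro ⟨a, b, hab, hn⟩
    exact h1 ⟨a, b, hx _ hab, fun hh => hn ⟨hsub hh.1, hsub hh.2⟩⟩
  · rintro ⟨a, b, hab, hn1, hn2⟩
    exact h2 ⟨a, b, hx _ hab, fun hh => hn1 (hsub hh), fun hh => hn2 (hsub hh)⟩
  · intro m ψ hm
    exact (h3 m ψ (hm.imp (hx _) (hx _))).imp (fun q => hsub q) (fun q => hsub q)

theorem step_sub {S S' : Finset Constraint} (h : OptStep S S') : S ⊆ S' := by
  rcases h with h | h | h
  · cases h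
    exact fun c hc => Finset.mem_insert_of_mem (Finset.mem_insert_of_mem hc)
  · cases h
    exact fun c hc => Finset.mem_insert_of_mem hc
  · obtain ⟨x, r, n, ψ, y, f, h, hc, hna, hno, hy, hf, hS'⟩ := h
    intro c hc
    have : c ∈ (S' : Set Constraint) := by
      rw [hS']; exact Or.inl (Or.inl hc)
    exact this

theorem inv_step {S S' : Finset Constraint} (hI : Inv S) (h : OptStep S S') : Inv S' := by
  have hsub := step_sub h
  rcases h with h | h | h
  · obtain ⟨x, a, b, h1, h2⟩ := h
    intro r u v huv
    have huv' : Constraint.rel r u v ∈ S := by simpa using huv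
    refine inv_edge_mono hsub ?_ (hI r u v huv')
    have hne : u ≠ x := by
      rintro rfl
      exact (hI r u v huv').1 ⟨a, b, h1, h2⟩
    intro ψ hψ
    simpa [hne] using hψ
  · obtain ⟨x, a, b, c, h1, h2, h3, h4⟩ := h
    intro r u v huv
    have huv' : Constraint.rel r u v ∈ S := by simpa using huv
    refine inv_edge_mono hsub ?_ (hI r u v huv')
    have hne : u ≠ x := by
      rintro rfl
      exact (hI r u v huv').2.1 ⟨a, b, h1, h2, h3⟩
    intro ψ hψ
    simpa [hne] using hψ
  · obtain ⟨x, r, n, ψ, y, f, h, hc, hna, hno, hy, hf, hS'⟩ := h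
    have mem : ∀ c, c ∈ S' ↔ ((c ∈ S ∨ (c = Constraint.rel r x y ∨ c = Constraint.sat y ψ)) ∨
        ∃ ψ' m, (Constraint.sat x (.ge r m ψ') ∈ S ∨ Constraint.sat x (.le r m ψ') ∈ S) ∧
            c = Constraint.sat y (f ψ')) := by
      intro c
      rw [← Finset.mem_coe, hS']
      rfl
    have old : ∀ u, u ≠ y → ∀ χ, Constraint.sat u χ ∈ S' → Constraint.sat u χ ∈ S := by
      intro u hu χ hχ
      rw [mem] at hχ
      simpa [hu] using hχ
    have hxy : x ≠ y := by
      rintro rfl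
      exact hy _ h (by simp [Constraint.vars])
    intro r' u v huv
    rw [mem] at huv
    rcases huv with (huv | huv | huv) | ⟨_, _, _, huv⟩
    · have hu : u ≠ y := by
        rintro rfl
        exact hy _ huv (by simp [Constraint.vars])
      exact inv_edge_mono hsub (old u hu) (hI r' u v huv)
    · obtain ⟨rfl, rfl, rfl⟩ : r' = r ∧ u = x ∧ v = y := by simpa using huv
      have := @inv_edge_mono S S' r' u v hsub (old u hxy)
      refine ⟨?_, ?_, ?_⟩
      · rintro ⟨a, b, hab, hn⟩
        exact hna ⟨a, b, old _ hxy _ hab, fun hh => hn ⟨hsub hh.1, hsub hh.2⟩⟩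
      · rintro ⟨a, b, hab, hn1, hn2⟩
        exact hno ⟨a, b, old _ hxy _ hab, fun hh => hn1 (hsub hh), fun hh => hn2 (hsub hh)⟩
      · intro m χ hm
        have hmem : Constraint.sat v (f χ) ∈ S' :=
          (mem _).2 (Or.inr ⟨χ, m, hm.imp (old _ hxy _) (old _ hxy _), rfl⟩)
        rcases hf χ with e | e <;> rw [e] at hmem
        · exact Or.inl hmem
        · exact Or.inr hmem
    · simp at huv
    · simp at huv

theorem reach_inv {x₀ : ℕ} {φ : GFormula} {S : Finset Constraint} (h : OptReach x₀ φ S) :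
    Inv S ∧ Constraint.sat x₀ φ ∈ S := by
  unfold OptReach at h
  induction h with
  | refl =>
    refine ⟨?_, by simp [initCS]⟩
    intro r x y hxy
    simp [initCS] at hxy
  | tail _ hs ih => exact ⟨inv_step ih.1 hs, step_sub hs ih.2⟩

theorem exists_fresh (S : Finset Constraint) : ∃ y, freshIn y S := by
  obtain ⟨y, hy⟩ := Infinite.exists_notMem_finset (S.biUnion Constraint.vars)
  exact ⟨y, fun c hc hyc => hy (Finset.mem_biUnion.2 ⟨c, hc, hyc⟩)⟩

theorem complete_and {S : Finset Constraint} (hcomp : OptComplete S) (x : ℕ) :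
    ¬ andApplicable S x := by
  rintro ⟨a, b, h1, h2⟩
  exact hcomp ⟨_, Or.inl (.mk S x a b h1 h2)⟩

theorem complete_or {S : Finset Constraint} (hcomp : OptComplete S) (x : ℕ) :
    ¬ orApplicable S x := by
  rintro ⟨a, b, h1, h2, h3⟩
  exact hcomp ⟨_, Or.inr (Or.inl (.mk S x a b a h1 h2 h3 (Or.inl rfl)))⟩

theorem complete_ge {S : Finset Constraint} (hcomp : OptComplete S) {x r n : ℕ} {ψ : GFormula}
    (h : Constraint.sat x (.ge r n ψ) ∈ S) : n ≤ countS S r x ψ := by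
  by_contra hlt
  push Not at hlt
  obtain ⟨y, hy⟩ := exists_fresh S
  have hfin : ((S : Set Constraint) ∪
          {Constraint.rel r x y, Constraint.sat y ψ} ∪
          {c | ∃ ψ' m,
            (Constraint.sat x (.ge r m ψ') ∈ S ∨ Constraint.sat x (.le r m ψ') ∈ S) ∧
            c = Constraint.sat y (id ψ')}).Finite := by
    refine ((Finset.finite_toSet S).union (Set.toFinite _)).union ?_
    let g : Constraint → Constraint := fun c => match c with
      | .sat _ (.ge _ _ χ) => .sat y χ
      | .sat _ (.le _ _ χ) => .sat y χ
      | c => c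
    refine ((Finset.finite_toSet S).image g).subset ?_
    rintro c ⟨χ, m, hm | hm, rfl⟩
    · exact ⟨_, hm, rfl⟩
    · exact ⟨_, hm, rfl⟩
  exact hcomp ⟨hfin.toFinset, Or.inr (Or.inr (.mk S _ x r n ψ y id h hlt (complete_and hcomp x)
    (complete_or hcomp x) hy (fun _ => Or.inl rfl) (Set.Finite.coe_toFinset hfin)))⟩

theorem succ_finite (S : Finset Constraint) (r x : ℕ) (P : ℕ → Prop) :
    {y : ℕ | Constraint.rel r x y ∈ S ∧ P y}.Finite := by
  have : {y : ℕ | Constraint.rel r x y ∈ S}.Finite :=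
    Set.Finite.preimage (f := fun y => Constraint.rel r x y)
      (fun a _ b _ h => by simpa using h) (Finset.finite_toSet S)
  exact this.subset fun y hy => hy.1

theorem mk_succ (S : Finset Constraint) (r x : ℕ) (P : ℕ → Prop) :
    Cardinal.mk {y : ℕ // Constraint.rel r x y ∈ S ∧ P y} =
      (Set.ncard {y : ℕ | Constraint.rel r x y ∈ S ∧ P y} : Cardinal) :=
  (Set.cast_ncard (succ_finite S r x P)).symm

theorem sat_ge_iff (S : Finset Constraint) (r n x : ℕ) (ψ : GFormula) :
    GFormula.sat (canonical S) (.ge r n ψ) x ↔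
      n ≤ Set.ncard {y : ℕ | Constraint.rel r x y ∈ S ∧ GFormula.sat (canonical S) ψ y} := by
  have := mk_succ S r x (fun y => GFormula.sat (canonical S) ψ y)
  change (n : Cardinal) ≤ Cardinal.mk {y : ℕ // Constraint.rel r x y ∈ S ∧ _} ↔ _
  rw [this]; exact Nat.cast_le

theorem sat_le_iff (S : Finset Constraint) (r n x : ℕ) (ψ : GFormula) :
    GFormula.sat (canonical S) (.le r n ψ) x ↔
      Set.ncard {y : ℕ | Constraint.rel r x y ∈ S ∧ GFormula.sat (canonical S) ψ y} ≤ n := by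
  have := mk_succ S r x (fun y => GFormula.sat (canonical S) ψ y)
  change Cardinal.mk {y : ℕ // Constraint.rel r x y ∈ S ∧ _} ≤ (n : Cardinal) ↔ _
  rw [this]; exact Nat.cast_le

theorem truth {S : Finset Constraint} (hI : Inv S) (hcomp : OptComplete S) (hcf : ¬ hasClash S)
    (ψ : GFormula) : ψ.isNNF →
    (∀ x, Constraint.sat x ψ ∈ S → GFormula.sat (canonical S) ψ x) ∧
    (∀ x, Constraint.sat x ψ.nnfNeg ∈ S → ¬ GFormula.sat (canonical S) ψ x) := by
  have hA : ∀ x a b, Constraint.sat x (.and a b) ∈ S →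
      Constraint.sat x a ∈ S ∧ Constraint.sat x b ∈ S := by
    intro x a b h
    by_contra hn
    exact complete_and hcomp x ⟨a, b, h, hn⟩
  have hO : ∀ x a b, Constraint.sat x (.or a b) ∈ S →
      Constraint.sat x a ∈ S ∨ Constraint.sat x b ∈ S := by
    intro x a b h
    by_contra hn
    push Not at hn
    exact complete_or hcomp x ⟨a, b, h, hn⟩
  have hC : ∀ x p, Constraint.sat x (.atom p) ∈ S → Constraint.sat x (.neg (.atom p)) ∈ S →
      False := fun x p h1 h2 => hcf (Or.inl ⟨x, p, h1, h2⟩)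
  have hL : ∀ x r n χ, Constraint.sat x (.le r n χ) ∈ S → countS S r x χ ≤ n := by
    intro x r n χ h
    by_contra hn
    exact hcf (Or.inr ⟨x, r, n, χ, h, not_le.1 hn⟩)
  have geCase : ∀ r n (χ : GFormula) x,
      (∀ x, Constraint.sat x χ ∈ S → GFormula.sat (canonical S) χ x) →
      Constraint.sat x (.ge r n χ) ∈ S →
      n ≤ Set.ncard {y : ℕ | Constraint.rel r x y ∈ S ∧ GFormula.sat (canonical S) χ y} := by
    intro r n χ x ih h
    refine (complete_ge hcomp h).trans (Set.ncard_le_ncard ?_ (succ_finite S r x _))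
    exact fun y hy => ⟨hy.1, ih y hy.2⟩
  have leCase : ∀ r n (χ : GFormula) x,
      (∀ x, Constraint.sat x χ.nnfNeg ∈ S → ¬ GFormula.sat (canonical S) χ x) →
      Constraint.sat x (.le r n χ) ∈ S →
      Set.ncard {y : ℕ | Constraint.rel r x y ∈ S ∧ GFormula.sat (canonical S) χ y} ≤ n := by
    intro r n χ x ih h
    refine le_trans (Set.ncard_le_ncard ?_ (succ_finite S r x _)) (hL x r n χ h)
    rintro y ⟨hy, hs⟩
    refine ⟨hy, ?_⟩
    rcases (hI r x y hy).2.2 n χ (Or.inr h) with h' | h'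
    · exact h'
    · exact absurd hs (ih y h')
  induction ψ with
  | atom p => exact fun _ => ⟨fun x h => h, fun x h h' => hC x p h' h⟩
  | neg a _ =>
    intro hn
    cases a with
    | atom p => exact ⟨fun x h h' => hC x p h' h, fun x h h' => h' h⟩
    | _ => exact absurd hn (by simp [GFormula.isNNF])
  | and a b iha ihb =>
    rintro ⟨na, nb⟩
    refine ⟨fun x h => ⟨(iha na).1 x (hA _ _ _ h).1, (ihb nb).1 x (hA _ _ _ h).2⟩, ?_⟩
    rintro x h ⟨ha, hb⟩
    rcases hO _ _ _ h with h | h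
    · exact (iha na).2 x h ha
    · exact (ihb nb).2 x h hb
  | or a b iha ihb =>
    rintro ⟨na, nb⟩
    refine ⟨fun x h => (hO _ _ _ h).imp ((iha na).1 x) ((ihb nb).1 x), ?_⟩
    intro x h hab
    have h' := hA _ _ _ h
    rcases hab with ha | hb
    · exact (iha na).2 x h'.1 ha
    · exact (ihb nb).2 x h'.2 hb
  | ge r n χ ih =>
    intro hn
    obtain ⟨i1, i2⟩ := ih hn
    refine ⟨fun x h => (sat_ge_iff S r n x χ).2 (geCase r n χ x i1 h), ?_⟩
    intro x h hs
    rw [sat_ge_iff] at hs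
    by_cases h0 : n = 0
    · simp only [GFormula.nnfNeg, h0, if_true] at h
      have := hA _ _ _ h
      exact hC _ _ this.1 this.2
    · simp only [GFormula.nnfNeg, h0, if_false] at h
      have := leCase _ _ _ _ i2 h
      omega
  | le r n χ ih =>
    intro hn
    obtain ⟨i1, i2⟩ := ih hn
    refine ⟨fun x h => (sat_le_iff S r n x χ).2 (leCase r n χ x i2 h), ?_⟩
    intro x h hs
    rw [sat_le_iff] at hs
    have := geCase _ _ _ _ i1 h
    omega

end GrK

open GrK in
/-- soundness of the optimised algorithm: if some sequence of
applications of the optimised rules starting from {x₀ ⊨ φ} (φ in NNF) yields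
a complete and clash-free c.s. S, then φ is satisfiable; indeed
M_S, x₀ ⊨ φ for the canonical structure M_S. -/
theorem stmt_13 (φ : GFormula) (hNNF : φ.isNNF) (x₀ : ℕ) (S : Finset Constraint)
    (hreach : OptReach x₀ φ S) (hcomp : OptComplete S) (hcf : ¬ hasClash S) :
    GFormula.sat (canonical S) φ x₀ ∧ φ.satisfiable := by
  obtain ⟨hI, h0⟩ := reach_inv hreach
  have h := (truth hI hcomp hcf φ hNNF).1 x₀ h0
  exact ⟨h, canonical S, x₀, h⟩
end
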